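/- Let I be a monomial ideal in k[ℕA] all of whose standard pairs belong to the face F. If (a,F) is a standard pair of I whose overlap class is maximal with respect to divisibility among the overlap classes of standard pairs of I, then for every b ∈ a + ℕF the colon ideal (I : t^b) equals p_F. -/

import Mathlib

open scoped BigOperators

namespace StdPairsPaper

/-- The coercion of a lattice point to a real vector. -/
def toR {d : ℕ} (v : Fin d → ℤ) : Fin d → ℝ := fun i => (v i : ℝ)

/-- The cone of nonnegative real combinations of (the real images of) elements of `S`. -/
def cone {d : ℕ} (S : Set (Fin d → ℤ)) : Set (Fin d → ℝ) :=
  {x | ∃ (t : Finset (Fin d → ℤ)) (c : (Fin d → ℤ) → ℝ),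
    (t : Set (Fin d → ℤ)) ⊆ S ∧ (∀ v, 0 ≤ c v) ∧ x = ∑ v ∈ t, c v • toR v}

/-- `ℕS`, the submonoid of `ℤ^d` generated by `S`. -/
def NSemi {d : ℕ} (S : Set (Fin d → ℤ)) : AddSubmonoid (Fin d → ℤ) :=
  AddSubmonoid.closure S

/-- `ℤS`, the subgroup of `ℤ^d` generated by `S`. -/
def ZGrp {d : ℕ} (S : Set (Fin d → ℤ)) : AddSubgroup (Fin d → ℤ) :=
  AddSubgroup.closure S

/-- `ℝS`, the real linear span of `S`. -/
def RSpan {d : ℕ} (S : Set (Fin d → ℤ)) : Submodule ℝ (Fin d → ℝ) :=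
  Submodule.span ℝ (toR '' S)

/-- `A` is a configuration: a finite set of nonzero lattice points whose `ℤ`-span is `ℤ^d`
and whose nonnegative real cone is strongly convex (contains no line, i.e. is pointed). -/
structure IsConfig {d : ℕ} (A : Set (Fin d → ℤ)) : Prop where
  (finite : A.Finite)
  (nonzero : (0 : Fin d → ℤ) ∉ A)
  (spans : ZGrp A = ⊤)
  (pointed : ∀ x ∈ cone A, -x ∈ cone A → x = 0)

/-- `F` is a face of the configuration `A`: `F ⊆ A`, the cone over `F` is an extreme
subset (face) of the cone over `A`, and `ℝ_{≥0}F ∩ A = F`. -/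
def IsFace {d : ℕ} (A F : Set (Fin d → ℤ)) : Prop :=
  F ⊆ A ∧ IsExtreme ℝ (cone A) (cone F) ∧ cone F ∩ (toR '' A) = toR '' F

/-- The set `a + ℕF`. -/
def cell {d : ℕ} (a : Fin d → ℤ) (F : Set (Fin d → ℤ)) : Set (Fin d → ℤ) :=
  {x | ∃ f ∈ NSemi F, x = a + f}

/-- Two pairs `(a,F)` and `(b,F)` belonging to the same face `F` overlap: `a - b ∈ ℤF`. -/
def Overlap {d : ℕ} (F : Set (Fin d → ℤ)) (a b : Fin d → ℤ) : Prop :=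
  a - b ∈ ZGrp F

/-- The pair `(a,F)` divides the pair `(b,G)`:
there is `c ∈ ℕA` with `a + c + ℕF ⊆ b + ℕG`. -/
def PairDvd {d : ℕ} (A : Set (Fin d → ℤ)) (a : Fin d → ℤ) (F : Set (Fin d → ℤ))
    (b : Fin d → ℤ) (G : Set (Fin d → ℤ)) : Prop :=
  ∃ c ∈ NSemi A, cell (a + c) F ⊆ cell b G

/-- `E` is the exponent set of a monomial ideal of `ℕA`: `E ⊆ ℕA` and `E + ℕA ⊆ E`. -/
def IsExpSet {d : ℕ} (A E : Set (Fin d → ℤ)) : Prop :=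
  E ⊆ (NSemi A : Set (Fin d → ℤ)) ∧ ∀ e ∈ E, ∀ c ∈ NSemi A, e + c ∈ E

/-- The standard monomials of `E`: `ℕA ∖ E`. -/
def stdSet {d : ℕ} (A E : Set (Fin d → ℤ)) : Set (Fin d → ℤ) :=
  (NSemi A : Set (Fin d → ℤ)) \ E

/-- `(a,F)` is a proper pair of `E`: a pair of `A` with `a + ℕF ⊆ std(E)`. -/
def ProperPair {d : ℕ} (A E : Set (Fin d → ℤ)) (a : Fin d → ℤ)
    (F : Set (Fin d → ℤ)) : Prop :=
  a ∈ NSemi A ∧ IsFace A F ∧ cell a F ⊆ stdSet A E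

/-- `(a,F)` is a standard pair of `E`: a proper pair of `E` maximal with respect to
the partial order `(a,F) ≼ (b,G) ↔ a + ℕF ⊆ b + ℕG`. -/
def StdPair {d : ℕ} (A E : Set (Fin d → ℤ)) (a : Fin d → ℤ)
    (F : Set (Fin d → ℤ)) : Prop :=
  ProperPair A E a F ∧
    ∀ b G, ProperPair A E b G → cell a F ⊆ cell b G → cell b G ⊆ cell a F

/-- The overlap class of the standard pair `(a,F)` of `E` is maximal with respect to
divisibility among overlap classes of standard pairs of `E`. -/
def MaxClass {d : ℕ} (A E : Set (Fin d → ℤ)) (a : Fin d → ℤ)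
    (F : Set (Fin d → ℤ)) : Prop :=
  ∀ b G, StdPair A E b G → PairDvd A a F b G → PairDvd A b G a F

noncomputable section

/-- The affine semigroup ring `k[ℕA]`. -/
abbrev SGRing {d : ℕ} (k : Type*) [Field k] (A : Set (Fin d → ℤ)) :=
  AddMonoidAlgebra k (NSemi A)

/-- The monomial `t^a` of `k[ℕA]`. -/
def mono {d : ℕ} (k : Type*) [Field k] (A : Set (Fin d → ℤ)) (a : (NSemi A)) :
    SGRing k A :=
  AddMonoidAlgebra.single a 1

/-- `I` is a monomial ideal of `k[ℕA]`: an ideal generated by monomials. -/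
def IsMonomialIdeal {d : ℕ} (k : Type*) [Field k] (A : Set (Fin d → ℤ))
    (I : Ideal (SGRing k A)) : Prop :=
  ∃ S : Set (NSemi A), I = Ideal.span ((fun a => mono k A a) '' S)

/-- The exponent set `E(I) = {a ∈ ℕA : t^a ∈ I}` of an ideal of `k[ℕA]`,
as a subset of `ℤ^d`. -/
def expSet {d : ℕ} (k : Type*) [Field k] (A : Set (Fin d → ℤ))
    (I : Ideal (SGRing k A)) : Set (Fin d → ℤ) :=
  {x | ∃ h : x ∈ NSemi A, mono k A ⟨x, h⟩ ∈ I}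

/-- The monomial prime ideal `p_F = ⟨t^a : a ∈ ℕA ∖ ℕF⟩` of `k[ℕA]`. -/
def primeF {d : ℕ} (k : Type*) [Field k] (A F : Set (Fin d → ℤ)) :
    Ideal (SGRing k A) :=
  Ideal.span {x | ∃ a : (NSemi A), (a : Fin d → ℤ) ∉ NSemi F ∧ x = mono k A a}

end

section Cones

variable {d : ℕ} {A F S : Set (Fin d → ℤ)}

lemma toR_injective : Function.Injective (toR : (Fin d → ℤ) → Fin d → ℝ) := by
  intro u v h
  funext i
  exact Int.cast_injective (congrFun h i)

lemma toR_zero : toR (0 : Fin d → ℤ) = 0 := by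
  funext i
  simp [toR]

lemma toR_add (u v : Fin d → ℤ) : toR (u + v) = toR u + toR v := by
  funext i
  simp [toR]

lemma toR_neg (u : Fin d → ℤ) : toR (-u) = -toR u := by
  funext i
  simp [toR]

lemma zero_mem_cone : (0 : Fin d → ℝ) ∈ cone S :=
  ⟨∅, 0, by simp, by simp, by simp⟩

lemma cone_empty : cone (∅ : Set (Fin d → ℤ)) = {0} := by
  refine Set.Subset.antisymm ?_ (Set.singleton_subset_iff.mpr zero_mem_cone)
  rintro x ⟨t, c, ht, -, rfl⟩
  have : t = ∅ := by simpa using ht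
  simp [this]

lemma toR_mem_cone {v : Fin d → ℤ} (hv : v ∈ S) : toR v ∈ cone S :=
  ⟨{v}, 1, by simpa using hv, by simp, by simp⟩

lemma smul_mem_cone {x : Fin d → ℝ} (hx : x ∈ cone S) {r : ℝ} (hr : 0 ≤ r) :
    r • x ∈ cone S := by
  obtain ⟨t, c, ht, hc, rfl⟩ := hx
  exact ⟨t, fun v => r * c v, ht, fun v => mul_nonneg hr (hc v), by
    simp [Finset.smul_sum, mul_smul]⟩

lemma add_mem_cone {x y : Fin d → ℝ} (hx : x ∈ cone S) (hy : y ∈ cone S) :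
    x + y ∈ cone S := by
  classical
  obtain ⟨s, b, hs, hb, rfl⟩ := hx
  obtain ⟨t, c, ht, hc, rfl⟩ := hy
  refine ⟨s ∪ t, fun v => (if v ∈ s then b v else 0) + (if v ∈ t then c v else 0),
    by simp [hs, ht], fun v => ?_, ?_⟩
  · have := hb v
    have := hc v
    positivity
  · simp only [add_smul, Finset.sum_add_distrib, ite_smul, zero_smul, Finset.sum_ite_mem]
    simp [Finset.inter_eq_right.mpr]

lemma toR_mem_cone_of_mem_NSemi {u : Fin d → ℤ} (hu : u ∈ NSemi S) : toR u ∈ cone S := by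
  induction hu using AddSubmonoid.closure_induction with
  | mem x hx => exact toR_mem_cone hx
  | zero => exact toR_zero (d := d) ▸ zero_mem_cone
  | add x y _ _ hx hy => exact toR_add x y ▸ add_mem_cone hx hy

lemma NSemi_mono (h : F ⊆ A) : NSemi F ≤ NSemi A :=
  AddSubmonoid.closure_mono h

lemma IsConfig.eq_zero_of_neg_mem (hA : IsConfig A) {u : Fin d → ℤ} (hu : u ∈ NSemi A)
    (hu' : -u ∈ NSemi A) : u = 0 := by
  apply toR_injective
  rw [toR_zero]
  exact hA.pointed _ (toR_mem_cone_of_mem_NSemi hu)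
    (toR_neg u ▸ toR_mem_cone_of_mem_NSemi hu')

lemma _root_.IsExtreme.mem_cone_of_add_mem (h : IsExtreme ℝ (cone A) (cone F))
    {x y : Fin d → ℝ} (hx : x ∈ cone A) (hy : y ∈ cone A) (hxy : x + y ∈ cone F) :
    x ∈ cone F := by
  refine h.left_mem_of_mem_openSegment hx hy (smul_mem_cone hxy (r := 1 / 2) (by norm_num)) ?_
  exact ⟨1 / 2, 1 / 2, by norm_num, by norm_num, by norm_num, (smul_add _ _ _).symm⟩

lemma IsConfig.isFace_empty (hA : IsConfig A) : IsFace A ∅ := by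
  refine ⟨Set.empty_subset _, ⟨?_, ?_⟩, ?_⟩
  · rw [cone_empty, Set.singleton_subset_iff]
    exact zero_mem_cone
  · intro x hx y hy z hz hzxy
    rw [cone_empty, Set.mem_singleton_iff] at hz ⊢
    obtain ⟨r, s, hr, hs, -, hrs⟩ := hzxy
    have h0 : r • x = 0 := by
      refine hA.pointed _ (smul_mem_cone hx hr.le) ?_
      have : -(r • x) = s • y := by
        rw [hz] at hrs
        exact neg_eq_of_add_eq_zero_right hrs
      exact this ▸ smul_mem_cone hy hs.le
    exact (smul_eq_zero.mp h0).resolve_left hr.ne'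
  · rw [cone_empty, Set.image_empty, Set.eq_empty_iff_forall_notMem]
    rintro x ⟨hx, v, hv, rfl⟩
    rw [Set.mem_singleton_iff, ← toR_zero] at hx
    exact hA.nonzero (toR_injective hx ▸ hv)

lemma IsFace.mem_NSemi_of_toR_mem_cone (hF : IsFace A F) {u : Fin d → ℤ} (hu : u ∈ NSemi A)
    (huF : toR u ∈ cone F) : u ∈ NSemi F := by
  induction hu using AddSubmonoid.closure_induction with
  | mem x hx =>
    have : toR x ∈ toR '' F := hF.2.2 ▸ ⟨huF, x, hx, rfl⟩
    exact AddSubmonoid.subset_closure (toR_injective.mem_set_image.mp this)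
  | zero => exact zero_mem _
  | add x y hxA hyA hx hy =>
    rw [toR_add] at huF
    have hx' := toR_mem_cone_of_mem_NSemi hxA
    have hy' := toR_mem_cone_of_mem_NSemi hyA
    exact add_mem (hx (hF.2.1.mem_cone_of_add_mem hx' hy' huF))
      (hy (hF.2.1.mem_cone_of_add_mem hy' hx' (add_comm (toR x) _ ▸ huF)))

lemma IsFace.mem_NSemi_of_add_mem (hF : IsFace A F) {u v : Fin d → ℤ} (hu : u ∈ NSemi A)
    (hv : v ∈ NSemi A) (huv : u + v ∈ NSemi F) : u ∈ NSemi F :=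
  hF.mem_NSemi_of_toR_mem_cone hu <|
    hF.2.1.mem_cone_of_add_mem (toR_mem_cone_of_mem_NSemi hu) (toR_mem_cone_of_mem_NSemi hv)
      (toR_add u v ▸ toR_mem_cone_of_mem_NSemi huv)

lemma IsFace.mem_of_mem_NSemi (hF : IsFace A F) {v : Fin d → ℤ} (hv : v ∈ A)
    (hvF : v ∈ NSemi F) : v ∈ F := by
  have : toR v ∈ toR '' F := hF.2.2 ▸ ⟨toR_mem_cone_of_mem_NSemi hvF, v, hv, rfl⟩
  exact toR_injective.mem_set_image.mp this

end Cones

section StandardPairs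

variable {d : ℕ} {A E F G H : Set (Fin d → ℤ)} {a b x : Fin d → ℤ}

lemma self_mem_cell (a : Fin d → ℤ) (F : Set (Fin d → ℤ)) : a ∈ cell a F :=
  ⟨0, zero_mem _, (add_zero a).symm⟩

lemma cell_subset_cell_of_mem (h : b ∈ cell a F) : cell b F ⊆ cell a F := by
  obtain ⟨f, hf, rfl⟩ := h
  rintro _ ⟨g, hg, rfl⟩
  exact ⟨f + g, add_mem hf hg, add_assoc _ _ _⟩

/-- Dickson's lemma for the affine semigroup `ℕA`. -/
lemma wellQuasiOrdered_NSemi (hA : A.Finite) :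
    WellQuasiOrdered fun u v : NSemi A => (v - u : Fin d → ℤ) ∈ NSemi A := by
  have := hA.fintype
  intro f
  have hf : ∀ n, ∃ c : A → ℕ, ∑ i, c i • (i : Fin d → ℤ) = f n := by
    intro n
    have hn : (f n : Fin d → ℤ) ∈ AddSubmonoid.closure (Set.range ((↑) : A → Fin d → ℤ)) := by
      rw [Subtype.range_coe]
      exact (f n).2
    exact (AddSubmonoid.mem_closure_range_iff_of_fintype.mp hn).imp fun _ h => h.symm
  choose g hg using hf
  obtain ⟨m, n, hmn, hle⟩ := wellQuasiOrdered_le g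
  refine ⟨m, n, hmn, ?_⟩
  have : (f n - f m : Fin d → ℤ) = ∑ i, (g n i - g m i) • (i : Fin d → ℤ) := by
    rw [← hg, ← hg, sub_eq_iff_eq_add, ← Finset.sum_add_distrib]
    exact Finset.sum_congr rfl fun i _ => by rw [← add_smul, Nat.sub_add_cancel (hle i)]
  beta_reduce
  rw [this]
  exact sum_mem fun i _ => nsmul_mem (AddSubmonoid.subset_closure i.2) _

lemma IsConfig.wellFounded (hA : IsConfig A) :
    WellFounded fun u v : NSemi A => (v - u : Fin d → ℤ) ∈ NSemi A ∧ u ≠ v := by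
  rw [wellFounded_iff_isEmpty_descending_chain]
  refine ⟨fun ⟨f, hf⟩ => ?_⟩
  obtain ⟨m, n, hmn, hle⟩ := wellQuasiOrdered_NSemi hA.finite f
  have hdesc : ∀ j, (f (m + 1) - f (m + 1 + j) : Fin d → ℤ) ∈ NSemi A := by
    intro j
    induction j with
    | zero => simp
    | succ j ih =>
      have := add_mem ih (hf (m + 1 + j)).1
      rwa [sub_add_sub_cancel] at this
  obtain ⟨j, rfl⟩ := Nat.exists_eq_add_of_le (Nat.succ_le_of_lt hmn)
  have hneg : -(f m - f (m + 1) : Fin d → ℤ) ∈ NSemi A := by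
    have := add_mem (hdesc j) hle
    rwa [sub_add_sub_cancel, ← neg_sub] at this
  have := hA.eq_zero_of_neg_mem (hf m).1 hneg
  exact (hf m).2 (Subtype.ext (sub_eq_zero.mp this).symm)

lemma face_subset_of_cell_subset (hG : G ⊆ A) (hH : IsFace A H) (h : cell a G ⊆ cell b H) :
    G ⊆ H := by
  intro g hg
  obtain ⟨u, hu, rfl⟩ := h (self_mem_cell a G)
  obtain ⟨v, hv, huv⟩ := h ⟨g, AddSubmonoid.subset_closure hg, rfl⟩
  have hgA : g ∈ NSemi A := AddSubmonoid.subset_closure (hG hg)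
  rw [add_assoc, add_right_inj, add_comm] at huv
  exact hH.mem_of_mem_NSemi (hG hg)
    (hH.mem_NSemi_of_add_mem hgA (NSemi_mono hH.1 hu) (huv ▸ hv))

/-- Every standard monomial lies in the cell of some standard pair. -/
lemma IsConfig.exists_stdPair (hA : IsConfig A) (hx : x ∈ stdSet A E) :
    ∃ a F, StdPair A E a F ∧ x ∈ cell a F := by
  let P : Set (Set (Fin d → ℤ)) := {G | ∃ a, ProperPair A E a G ∧ x ∈ cell a G}
  have hPfin : P.Finite := hA.finite.finite_subsets.subset fun G ⟨_, hG, _⟩ => hG.2.1.1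
  have hPne : P.Nonempty := by
    refine ⟨∅, x, ⟨hx.1, hA.isFace_empty, ?_⟩, self_mem_cell _ _⟩
    rintro _ ⟨f, hf, rfl⟩
    have : f = 0 := by simpa [NSemi] using hf
    simpa [this] using hx
  obtain ⟨G, ⟨a₀, ha₀, hxa₀⟩, hGmax⟩ := hPfin.exists_maximal hPne
  let Q : Set (NSemi A) := {a | ProperPair A E a G ∧ x ∈ cell a G}
  obtain ⟨a, ⟨ha, hxa⟩, hamin⟩ :=
    hA.wellFounded.has_min Q ⟨⟨a₀, ha₀.1⟩, ha₀, hxa₀⟩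
  refine ⟨a, G, ⟨ha, fun b H hb hab => ?_⟩, hxa⟩
  have hGH : G ⊆ H := face_subset_of_cell_subset ha.2.1.1 hb.2.1 hab
  obtain rfl : G = H := hGH.antisymm (hGmax ⟨b, hb, hab hxa⟩ hGH)
  obtain ⟨u, hu, hau⟩ := hab (self_mem_cell _ _)
  have hmin := hamin ⟨b, hb.1⟩ ⟨hb, hab hxa⟩
  have heq : (⟨b, hb.1⟩ : NSemi A) = a := by
    by_contra hne
    refine hmin ⟨?_, hne⟩
    simpa [hau] using NSemi_mono hb.2.1.1 hu
  rw [← heq]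

end StandardPairs

section MonomialIdeals

variable {d : ℕ} {k : Type*} [Field k] {A F : Set (Fin d → ℤ)}

lemma mono_mul_mono (u v : NSemi A) : mono k A u * mono k A v = mono k A (u + v) := by
  simp [mono, AddMonoidAlgebra.single_mul_single]

lemma mem_span_mono_iff {S : Set (NSemi A)} {f : SGRing k A} :
    f ∈ Ideal.span ((fun a => mono k A a) '' S) ↔
      ∀ m ∈ f.coeff.support, ∃ m' ∈ S, ∃ c, m = c + m' :=
  AddMonoidAlgebra.mem_ideal_span_of'_image

lemma primeF_eq_span_image :
    primeF k A F =
      Ideal.span ((fun a => mono k A a) '' {a : NSemi A | (a : Fin d → ℤ) ∉ NSemi F}) := by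
  unfold primeF
  congr 1
  ext x
  simp [eq_comm]

lemma IsMonomialIdeal.mono_mem {I : Ideal (SGRing k A)} (hI : IsMonomialIdeal k A I)
    {f : SGRing k A} (hf : f ∈ I) {m : NSemi A} (hm : m ∈ f.coeff.support) :
    mono k A m ∈ I := by
  obtain ⟨S, rfl⟩ := hI
  obtain ⟨m', hm', c, rfl⟩ := mem_span_mono_iff.mp hf m hm
  rw [← mono_mul_mono]
  exact Ideal.mul_mem_left _ _ (Ideal.subset_span ⟨m', hm', rfl⟩)

lemma add_mem_support_mul_mono {f : SGRing k A} {m : NSemi A} (hm : m ∈ f.coeff.support)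
    (b : NSemi A) : m + b ∈ (f * mono k A b).coeff.support := by
  rw [Finsupp.mem_support_iff] at hm ⊢
  rwa [mono, AddMonoidAlgebra.coeff_mul_single_eq_coeff_mul (m₂ := m), mul_one]
  intro c _
  exact add_left_inj b

end MonomialIdeals

/-- If all standard pairs of the monomial ideal `I` belong to `F` and
`(a,F)` is a standard pair whose overlap class is maximal with respect to divisibility,
then for every `b ∈ a + ℕF` the colon ideal `(I : t^b)` equals `p_F`. -/
theorem colon_eq_primeF_of_maximal_class {d : ℕ} (k : Type*) [Field k]
    (A : Set (Fin d → ℤ)) (hA : IsConfig A)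
    (F : Set (Fin d → ℤ)) (hF : IsFace A F)
    (I : Ideal (SGRing k A)) (hI : IsMonomialIdeal k A I)
    (hall : ∀ a' G, StdPair A (expSet k A I) a' G → G = F)
    (a : Fin d → ℤ) (hstd : StdPair A (expSet k A I) a F)
    (hmax : MaxClass A (expSet k A I) a F)
    (b : Fin d → ℤ) (hb : b ∈ cell a F) (hbA : b ∈ NSemi A) :
    Submodule.colon I (Ideal.span {mono k A ⟨b, hbA⟩}) = primeF k A F := by
  have hstdCell : ∀ f ∈ NSemi F, b + f ∉ expSet k A I := fun f hf =>
    (hstd.1.2.2 (cell_subset_cell_of_mem hb ⟨f, hf, rfl⟩)).2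
  have hexp : ∀ c ∈ NSemi A, c ∉ NSemi F → c + b ∈ expSet k A I := by
    intro c hc hcF
    by_contra hcb
    obtain ⟨a', G, hG, hmem⟩ := hA.exists_stdPair (E := expSet k A I) ⟨add_mem hc hbA, hcb⟩
    obtain rfl := hall a' G hG
    obtain ⟨f, hf, rfl⟩ := hb
    have hdvd : PairDvd A a G a' G := by
      refine ⟨c + f, add_mem hc (NSemi_mono hF.1 hf), cell_subset_cell_of_mem ?_⟩
      rwa [add_left_comm]
    obtain ⟨c', hc', hsub⟩ := hmax a' G hG hdvd
    obtain ⟨f', hf', h'⟩ := hmem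
    obtain ⟨f'', hf'', h''⟩ := hsub (self_mem_cell _ _)
    have hsum : c + (f + c') = f' + f'' := by
      have : a + (c + (f + c')) = a + (f' + f'') := by
        linear_combination h' + h''
      exact add_left_cancel this
    exact hcF (hF.mem_NSemi_of_add_mem hc (add_mem (NSemi_mono hF.1 hf) hc')
      (hsum ▸ add_mem hf' hf''))
  refine le_antisymm (fun f hf => ?_) (Ideal.span_le.mpr ?_)
  · rw [Ideal.mem_colon_span_singleton] at hf
    rw [primeF_eq_span_image, mem_span_mono_iff]
    refine fun m hm => ⟨m, fun hmF => hstdCell m hmF ?_, 0, (zero_add m).symm⟩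
    have := hI.mono_mem hf (add_mem_support_mul_mono hm ⟨b, hbA⟩)
    rw [add_comm]
    exact ⟨add_mem m.2 hbA, this⟩
  · rintro _ ⟨c, hc, rfl⟩
    rw [SetLike.mem_coe, Ideal.mem_colon_span_singleton, mono_mul_mono]
    exact (hexp c c.2 hc).2

end StdPairsPaper
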